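/- arXiv:math/0503518 — 6 statements merged into one kernel-verified Lean document; each statement's English description precedes it below -/
import Mathlib

section
/- Let μ > 0 and let w : [0,∞) → ℝ be measurable and locally bounded. If x : [0,∞) → ℝ is measurable, locally bounded and satisfies x(t) = w(t) − μ ∫₀ᵗ x(s) ds for all t ≥ 0, then |x(t)| ≤ 2 · sup_{0 ≤ s ≤ t} |w(s)| for every t ≥ 0. -/
open MeasureTheory Set

/-- `(𝔍 f) t = ∫₀ᵗ f(s) ds`. -/
noncomputable def 𝔍 (f : ℝ → ℝ) (t : ℝ) : ℝ := ∫ s in (0:ℝ)..t, f s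

/-- An integral starting at `0` cannot exceed a level `c ≥ 0` if the integrand is nonpositive
whenever the integral is above that level. -/
theorem 𝔍_le_of_nonpos_above {f : ℝ → ℝ} {t c : ℝ} (ht : 0 ≤ t) (hc : 0 ≤ c)
    (hf : IntegrableOn f (Icc 0 t)) (h : ∀ s ∈ Icc 0 t, c < 𝔍 f s → f s ≤ 0) :
    𝔍 f t ≤ c := by
  have hcont : ContinuousOn (𝔍 f) (Icc 0 t) := by
    have := intervalIntegral.continuousOn_primitive_interval (μ := volume) (f := f)
      (a := 0) (b := t) (by rwa [uIcc_of_le ht])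
    rwa [uIcc_of_le ht] at this
  have hcompact : IsCompact (Icc 0 t ∩ 𝔍 f ⁻¹' Iic c) :=
    isCompact_Icc.of_isClosed_subset (hcont.preimage_isClosed_of_isClosed isClosed_Icc isClosed_Iic)
      inter_subset_left
  obtain ⟨s, ⟨hs, hsc⟩, hmax⟩ := hcompact.exists_isGreatest
    ⟨0, ⟨le_rfl, ht⟩, by simpa [𝔍] using hc⟩
  have hint : ∀ a ∈ Icc 0 t, ∀ b ∈ Icc 0 t, IntervalIntegrable f volume a b := fun a ha b hb =>
    (hf.mono_set (Icc_subset_Icc (le_min ha.1 hb.1) (max_le ha.2 hb.2))).intervalIntegrable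
  have hsplit : 𝔍 f s + ∫ r in s..t, f r = 𝔍 f t :=
    intervalIntegral.integral_add_adjacent_intervals
      (hint 0 ⟨le_rfl, ht⟩ s hs) (hint s hs t ⟨ht, le_rfl⟩)
  have hnonpos : ∫ r in s..t, f r ≤ 0 := by
    rw [intervalIntegral.integral_of_le hs.2]
    refine setIntegral_nonpos measurableSet_Ioc fun r hr => ?_
    have hr' : r ∈ Icc 0 t := ⟨hs.1.trans hr.1.le, hr.2⟩
    exact h r hr' (lt_of_not_ge fun hle => (hmax ⟨hr', hle⟩).not_gt hr.1)
  have hsc' : 𝔍 f s ≤ c := hsc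
  linarith

/-- Lemma 1, second part: if `μ > 0` and `x = w − μ 𝔍x`, then
`|x(t)| ≤ 2 sup_{0 ≤ s ≤ t} |w(s)|` for every `t ≥ 0`. -/
theorem abs_le_two_mul_sup_of_integral_equation
    (μ : ℝ) (hμ : 0 < μ) (w x : ℝ → ℝ)
    (hw_meas : Measurable w)
    (hw_bdd : ∀ T : ℝ, ∃ C : ℝ, ∀ t ∈ Icc (0:ℝ) T, |w t| ≤ C)
    (hx_meas : Measurable x)
    (hx_bdd : ∀ T : ℝ, ∃ C : ℝ, ∀ t ∈ Icc (0:ℝ) T, |x t| ≤ C)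
    (hx : ∀ t : ℝ, 0 ≤ t → x t = w t - μ * 𝔍 x t) :
    ∀ t : ℝ, 0 ≤ t → |x t| ≤ 2 * sSup ((fun s => |w s|) '' Icc 0 t) := by
  intro t ht
  obtain ⟨C, hC⟩ := hw_bdd t
  obtain ⟨D, hD⟩ := hx_bdd t
  set M := sSup ((fun s => |w s|) '' Icc 0 t)
  have hM : ∀ s ∈ Icc 0 t, |w s| ≤ M := fun s hs =>
    le_csSup ⟨C, by rintro _ ⟨r, hr, rfl⟩; exact hC r hr⟩ ⟨s, hs, rfl⟩
  have hM0 : 0 ≤ M := (abs_nonneg _).trans (hM 0 ⟨le_rfl, ht⟩)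
  have hint : IntegrableOn x (Icc 0 t) :=
    Measure.integrableOn_of_bounded (M := D) measure_Icc_lt_top.ne hx_meas.aestronglyMeasurable
      ((ae_restrict_iff' measurableSet_Icc).2 (ae_of_all _ hD))
  have hneg : ∀ s, 𝔍 (fun r => -x r) s = -𝔍 x s := fun s => intervalIntegral.integral_neg
  have hupper : 𝔍 x t ≤ M / μ := by
    refine 𝔍_le_of_nonpos_above ht (by positivity) hint fun s hs h => ?_
    rw [div_lt_iff₀' hμ] at h
    linarith [hx s hs.1, (abs_le.1 (hM s hs)).2]
  have hlower : 𝔍 (fun r => -x r) t ≤ M / μ := by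
    refine 𝔍_le_of_nonpos_above ht (by positivity) hint.neg fun s hs h => ?_
    rw [hneg, div_lt_iff₀' hμ] at h
    linarith [hx s hs.1, (abs_le.1 (hM s hs)).1]
  rw [hneg, le_div_iff₀' hμ] at hlower
  rw [le_div_iff₀' hμ] at hupper
  have hwt := abs_le.1 (hM t ⟨ht, le_rfl⟩)
  rw [hx t ht, abs_le]
  constructor <;> linarith [hwt.1, hwt.2]
end

section
/- Let μ ≥ 0 and let w : [0,∞) → ℝ be measurable, locally bounded, nondecreasing and satisfy w(0) ≥ 0. If x : [0,∞) → ℝ is measurable, locally bounded and satisfies x(t) = w(t) − μ ∫₀ᵗ x(s) ds for all t ≥ 0, then x(t) ≥ w(t) e^{−μ t} ≥ 0 for every t ≥ 0. -/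
open MeasureTheory Set

/-- A continuous function on `[a, b]` that starts nonpositive, and does not increase across any
subinterval `[s, b]` on whose interior it is positive, ends nonpositive. -/
theorem nonpos_right_of_le_of_pos {a b : ℝ} (hab : a ≤ b) {h : ℝ → ℝ}
    (hc : ContinuousOn h (Icc a b)) (ha : h a ≤ 0)
    (hstep : ∀ s ∈ Icc a b, (∀ r ∈ Ioc s b, 0 < h r) → h b ≤ h s) : h b ≤ 0 := by
  have hcompact : IsCompact (Icc a b ∩ h ⁻¹' Iic 0) :=
    isCompact_Icc.of_isClosed_subset (hc.preimage_isClosed_of_isClosed isClosed_Icc isClosed_Iic)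
      inter_subset_left
  obtain ⟨s, ⟨hs, hs0⟩, hmax⟩ :=
    hcompact.exists_isGreatest ⟨a, left_mem_Icc.2 hab, ha⟩
  refine (hstep s hs fun r hr => ?_).trans hs0
  by_contra! hr0
  exact (hmax ⟨⟨hs.1.trans hr.1.le, hr.2⟩, hr0⟩).not_gt hr.1

/-- A measurable function that is bounded on `[0, T]` is interval integrable there. -/
theorem intervalIntegrable_of_abs_le {f : ℝ → ℝ} (hf : Measurable f) {T C : ℝ} (hT : 0 ≤ T)
    (hC : ∀ t ∈ Icc 0 T, |f t| ≤ C) : IntervalIntegrable f volume 0 T := by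
  rw [intervalIntegrable_iff_integrableOn_Icc_of_le hT]
  refine Measure.integrableOn_of_bounded (M := C) (by simp) hf.aestronglyMeasurable ?_
  exact (ae_restrict_iff' measurableSet_Icc).2 (Filter.Eventually.of_forall hC)

theorem integral_mul_exp_neg_mul (μ c s t : ℝ) :
    ∫ r in s..t, μ * (c * Real.exp (-μ * r)) =
      c * Real.exp (-μ * s) - c * Real.exp (-μ * t) := by
  have hderiv : ∀ r ∈ uIcc s t, HasDerivAt (fun r => -(c * Real.exp (-μ * r)))
      (μ * (c * Real.exp (-μ * r))) r := by
    intro r _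
    have hlin : HasDerivAt (fun r => -μ * r) (-μ) r := by
      simpa using (hasDerivAt_id r).const_mul (-μ)
    exact (hlin.exp.const_mul c).fun_neg.congr_deriv (by ring)
  rw [intervalIntegral.integral_eq_sub_of_hasDerivAt hderiv
    (Continuous.intervalIntegrable (by fun_prop) _ _)]
  ring

/-- if `μ ≥ 0`, `w` is nondecreasing on `[0,∞)` with `w(0) ≥ 0`, and
`x = w − μ 𝔍x`, then `x(t) ≥ w(t) e^{−μt} ≥ 0` for all `t ≥ 0`. -/
theorem solution_ge_exp_of_monotone
    (μ : ℝ) (hμ : 0 ≤ μ) (w x : ℝ → ℝ)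
    (hw_meas : Measurable w)
    (hw_bdd : ∀ T : ℝ, ∃ C : ℝ, ∀ t ∈ Icc (0:ℝ) T, |w t| ≤ C)
    (hw_mono : ∀ s t : ℝ, 0 ≤ s → s ≤ t → w s ≤ w t)
    (hw0 : 0 ≤ w 0)
    (hx_meas : Measurable x)
    (hx_bdd : ∀ T : ℝ, ∃ C : ℝ, ∀ t ∈ Icc (0:ℝ) T, |x t| ≤ C)
    (hx : ∀ t : ℝ, 0 ≤ t → x t = w t - μ * 𝔍 x t) :
    ∀ t : ℝ, 0 ≤ t → w t * Real.exp (-μ * t) ≤ x t ∧ 0 ≤ w t * Real.exp (-μ * t) := by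
  intro T hT
  refine ⟨?_, mul_nonneg (hw0.trans (hw_mono 0 T le_rfl hT)) (Real.exp_pos _).le⟩
  have hint : ∀ t, 0 ≤ t → IntervalIntegrable x volume 0 t := fun t ht =>
    intervalIntegrable_of_abs_le hx_meas ht (hx_bdd t).choose_spec
  have hcont : ContinuousOn (𝔍 x) (Icc 0 T) := by
    have := intervalIntegral.continuousOn_primitive_interval
      ((intervalIntegrable_iff_integrableOn_Icc_of_le hT).1 (hint T hT) |>.mono_set
        (uIcc_of_le hT).subset)
    rwa [uIcc_of_le hT] at this
  have key : μ * 𝔍 x T - w T * (1 - Real.exp (-μ * T)) ≤ 0 := by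
    refine nonpos_right_of_le_of_pos
      (h := fun t => μ * 𝔍 x t - w T * (1 - Real.exp (-μ * t))) hT ?_ (by simp [𝔍]) ?_
    · exact (continuousOn_const.mul hcont).sub (Continuous.continuousOn (by fun_prop))
    · intro s hs hpos
      have hxs := hint s hs.1
      have hsT : IntervalIntegrable x volume s T := hxs.symm.trans (hint T hT)
      have hle : ∫ r in s..T, μ * x r ≤ ∫ r in s..T, μ * (w T * Real.exp (-μ * r)) := by
        refine intervalIntegral.integral_mono_on_of_le_Ioo hs.2 (hsT.const_mul μ)
          (Continuous.intervalIntegrable (by fun_prop) _ _) fun r hr => ?_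
        have hr0 : 0 ≤ r := hs.1.trans hr.1.le
        have hr1 := hpos r ⟨hr.1, hr.2.le⟩
        refine mul_le_mul_of_nonneg_left ?_ hμ
        linarith [hx r hr0, hw_mono r T hr0 hr.2.le]
      rw [integral_mul_exp_neg_mul, intervalIntegral.integral_const_mul] at hle
      have hadd : 𝔍 x s + ∫ r in s..T, x r = 𝔍 x T :=
        intervalIntegral.integral_add_adjacent_intervals hxs hsT
      simp only [← hadd]
      linarith
  linarith [hx T hT]
end

section
/- There exists a constant m₁ > 0, depending only on I, J, E, μ and θ, such that the following holds: whenever continuous functions x_i, y_i, w_i : [0,∞) → ℝ (i ∈ I), z_j : [0,∞) → ℝ (j ∈ J) and ψ_ij : [0,∞) → ℝ (with ψ_ij ≡ 0 for (i,j) ∉ E) satisfy the system x_i(t) = w_i(t) − ∑_{j∈J} μ_ij (𝔍ψ_ij)(t) − θ_i (𝔍y_i)(t), ∑_{j∈J} ψ_ij(t) = x_i(t) − y_i(t), and ∑_{i∈I} ψ_ij(t) = −z_j(t) for all t ≥ 0, then for every t ≥ 0: ∑_{(i,j)∈I×J} |(𝔍ψ_ij)(t)| + ∑_{i∈I} |x_i(t)|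 ≤ m₁ ( sup_{0≤s≤t} ∑_{i∈I} |w_i(s)| + sup_{0≤s≤t} ∑_{i∈I} |(𝔍y_i)(s)| + sup_{0≤s≤t} ∑_{j∈J} |(𝔍z_j)(s)| ). -/
open MeasureTheory Set

/-- The bipartite graph on `I ⊕ J` with an edge between `i : I` and `j : J`
iff `(i, j) ∈ E`. -/
def actGraph {I J : Type*} (E : Set (I × J)) : SimpleGraph (I ⊕ J) :=
  SimpleGraph.fromRel (fun a b => ∃ i j, a = Sum.inl i ∧ b = Sum.inr j ∧ (i, j) ∈ E)

/-- A finite forest with at least one edge has a leaf. -/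
lemma SimpleGraph.IsAcyclic.exists_adj_forall_adj_eq {V : Type*} {G : SimpleGraph V}
    [Finite G.edgeSet] (hG : G.IsAcyclic) {a b : V} (hab : G.Adj a b) :
    ∃ u w, G.Adj u w ∧ ∀ w', G.Adj u w' → w' = w := by
  have : Nonempty V := ⟨a⟩
  obtain ⟨u, v, p, hp, hmax⟩ := SimpleGraph.Walk.exists_isPath_forall_isPath_length_le_length G
  have hnil : ¬p.Nil := by
    intro h
    have hle := hmax _ _ hab.toWalk (by simp [hab.ne])
    have := SimpleGraph.Walk.length_eq_zero_iff.mpr h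
    simp at hle
    omega
  refine ⟨u, _, p.adj_snd hnil, fun w hadj ↦ hG.eq_snd_of_adj_start hp hadj ?_⟩
  by_contra hw
  have := hmax _ _ (p.cons hadj.symm) (hp.cons hw)
  simp at this

lemma actGraph_adj_inl_inr {I J : Type*} {E : Set (I × J)} {i : I} {j : J} :
    (actGraph E).Adj (Sum.inl i) (Sum.inr j) ↔ (i, j) ∈ E := by
  simp [actGraph]

lemma actGraph_not_adj_inl_inl {I J : Type*} {E : Set (I × J)} {i i' : I} :
    ¬ (actGraph E).Adj (Sum.inl i) (Sum.inl i') := by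
  simp [actGraph]

lemma actGraph_not_adj_inr_inr {I J : Type*} {E : Set (I × J)} {j j' : J} :
    ¬ (actGraph E).Adj (Sum.inr j) (Sum.inr j') := by
  simp [actGraph]

lemma actGraph_mono {I J : Type*} {E F : Set (I × J)} (h : E ⊆ F) :
    actGraph E ≤ actGraph F := by
  rintro (i | j) (i' | j') hadj
  · exact absurd hadj actGraph_not_adj_inl_inl
  · exact actGraph_adj_inl_inr.mpr (h (actGraph_adj_inl_inr.mp hadj))
  · exact (actGraph_adj_inl_inr.mpr (h (actGraph_adj_inl_inr.mp hadj.symm))).symm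
  · exact absurd hadj actGraph_not_adj_inr_inr

/-- A solution of `f' + a f ≤ K` started at `0` stays below `K / a`. -/
lemma le_div_of_hasDerivAt_add_mul_le {f f' : ℝ → ℝ} {a K T : ℝ} (ha : 0 < a) (hK : 0 ≤ K)
    (hf : ∀ s, HasDerivAt f (f' s) s) (h0 : f 0 = 0)
    (hle : ∀ s ∈ Icc 0 T, f' s + a * f s ≤ K) : ∀ s ∈ Icc 0 T, f s ≤ K / a := by
  intro s hs
  have hderiv : ∀ r, HasDerivAt (fun r ↦ Real.exp (a * r) * (f r - K / a))
      (Real.exp (a * r) * (f' r + a * f r - K)) r := by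
    intro r
    have h1 : HasDerivAt (fun r ↦ Real.exp (a * r)) (Real.exp (a * r) * (a * 1)) r :=
      ((hasDerivAt_id r).const_mul a).exp
    refine (h1.mul ((hf r).sub_const (K / a))).congr_deriv ?_
    have : a * (K / a) = K := mul_div_cancel₀ K ha.ne'
    linear_combination -Real.exp (a * r) * this
  have hanti : AntitoneOn (fun r ↦ Real.exp (a * r) * (f r - K / a)) (Icc 0 T) := by
    refine antitoneOn_of_deriv_nonpos (convex_Icc 0 T)
      (fun r _ ↦ (hderiv r).continuousAt.continuousWithinAt)
      (fun r _ ↦ (hderiv r).differentiableAt.differentiableWithinAt) fun r hr ↦ ?_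
    rw [(hderiv r).deriv]
    exact mul_nonpos_of_nonneg_of_nonpos (Real.exp_pos _).le
      (sub_nonpos.mpr (hle r (interior_subset hr)))
  have h := hanti ⟨le_rfl, hs.1.trans hs.2⟩ hs hs.1
  simp only [mul_zero, Real.exp_zero, one_mul, h0, zero_sub] at h
  have hKa : 0 ≤ K / a := by positivity
  have := nonpos_of_mul_nonpos_right (h.trans (neg_nonpos.mpr hKa)) (Real.exp_pos _)
  linarith

lemma abs_le_div_of_abs_hasDerivAt_add_mul_le {f f' : ℝ → ℝ} {a K T : ℝ} (ha : 0 < a)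
    (hK : 0 ≤ K) (hf : ∀ s, HasDerivAt f (f' s) s) (h0 : f 0 = 0)
    (hle : ∀ s ∈ Icc 0 T, |f' s + a * f s| ≤ K) : ∀ s ∈ Icc 0 T, |f s| ≤ K / a := by
  refine fun s hs ↦ abs_le'.mpr ⟨le_div_of_hasDerivAt_add_mul_le ha hK hf h0
    (fun r hr ↦ (abs_le.mp (hle r hr)).2) s hs, ?_⟩
  refine le_div_of_hasDerivAt_add_mul_le (f := fun s ↦ -f s) (f' := fun s ↦ -f' s) ha hK
    (fun r ↦ (hf r).neg) (by simp [h0]) (fun r hr ↦ ?_) s hs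
  have := (abs_le.mp (hle r hr)).1
  linarith

lemma abs_sum_mul_le {ι : Type*} (s : Finset ι) (c f C : ι → ℝ) {M : ℝ}
    (h : ∀ k ∈ s, |f k| ≤ C k * M) : |∑ k ∈ s, c k * f k| ≤ (∑ k ∈ s, |c k| * C k) * M := by
  rw [Finset.sum_mul]
  refine (Finset.abs_sum_le_sum_abs _ _).trans (Finset.sum_le_sum fun k hk ↦ ?_)
  rw [abs_mul, mul_assoc]
  exact mul_le_mul_of_nonneg_left (h k hk) (abs_nonneg _)

section Flow

variable {I J : Type*} [Fintype I] [Fintype J]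

/-- The integrated model equations on `[0, T]`: `X`, `Y`, `Z`, `Ψ` stand for the primitives of
`x`, `y`, `z`, `ψ`, and the data `W`, `Y`, `Z` are bounded by `M`. -/
structure IsIntegratedFlow (E : Set (I × J)) (μ : I × J → ℝ) (θ : I → ℝ) (T M : ℝ)
    (X x Y W : I → ℝ → ℝ) (Z : J → ℝ → ℝ) (Ψ : I → J → ℝ → ℝ) : Prop where
  X_zero : ∀ i, X i 0 = 0
  hasDerivAt : ∀ i s, HasDerivAt (X i) (x i s) s
  off : ∀ i j, (i, j) ∉ E → ∀ s, Ψ i j s = 0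
  state : ∀ i, ∀ s ∈ Icc 0 T, x i s = W i s - ∑ j, μ (i, j) * Ψ i j s - θ i * Y i s
  row : ∀ i, ∀ s ∈ Icc 0 T, ∑ j, Ψ i j s = X i s - Y i s
  col : ∀ j, ∀ s ∈ Icc 0 T, ∑ i, Ψ i j s = -Z j s
  abs_W_le : ∀ i, ∀ s ∈ Icc 0 T, |W i s| ≤ M
  abs_Y_le : ∀ i, ∀ s ∈ Icc 0 T, |Y i s| ≤ M
  abs_Z_le : ∀ j, ∀ s ∈ Icc 0 T, |Z j s| ≤ M

/-- The integrated activity at `p` is bounded by the data, uniformly over all flows. -/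
def IsDominated (E : Set (I × J)) (μ : I × J → ℝ) (θ : I → ℝ) (p : I × J) : Prop :=
  ∃ C : ℝ, 0 ≤ C ∧ ∀ (T M : ℝ) (X x Y W : I → ℝ → ℝ) (Z : J → ℝ → ℝ) (Ψ : I → J → ℝ → ℝ),
    IsIntegratedFlow E μ θ T M X x Y W Z Ψ → ∀ s ∈ Icc 0 T, |Ψ p.1 p.2 s| ≤ C * M

variable {E : Set (I × J)} {μ : I × J → ℝ} {θ : I → ℝ}

lemma IsIntegratedFlow.nonneg {T M : ℝ} {X x Y W : I → ℝ → ℝ} {Z : J → ℝ → ℝ}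
    {Ψ : I → J → ℝ → ℝ} (h : IsIntegratedFlow E μ θ T M X x Y W Z Ψ) (i : I) {s : ℝ}
    (hs : s ∈ Icc 0 T) : 0 ≤ M :=
  (abs_nonneg _).trans (h.abs_W_le i s hs)

lemma isDominated_of_notMem {p : I × J} (hp : p ∉ E) : IsDominated E μ θ p :=
  ⟨0, le_rfl, fun T M X x Y W Z Ψ h s _ ↦ by simp [h.off p.1 p.2 hp s]⟩

lemma isDominated_of_forall_column {i : I} {j : J}
    (h : ∀ i', i' ≠ i → IsDominated E μ θ (i', j)) : IsDominated E μ θ (i, j) := by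
  classical
  choose! C hC hbound using h
  refine ⟨1 + ∑ i' ∈ Finset.univ.erase i, |1| * C i', ?_,
    fun T M X x Y W Z Ψ hflow s hs ↦ ?_⟩
  · have : 0 ≤ ∑ i' ∈ Finset.univ.erase i, |1| * C i' := Finset.sum_nonneg fun i' hi' ↦
      mul_nonneg (abs_nonneg _) (hC i' (Finset.ne_of_mem_erase hi'))
    linarith
  · have hcol := hflow.col j s hs
    rw [← Finset.add_sum_erase _ _ (Finset.mem_univ i)] at hcol
    have hsum := abs_sum_mul_le (Finset.univ.erase i) (fun _ ↦ 1) (fun i' ↦ Ψ i' j s) C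
      fun i' hi' ↦ hbound i' (Finset.ne_of_mem_erase hi') T M X x Y W Z Ψ hflow s hs
    simp only [one_mul] at hsum
    have hZ := hflow.abs_Z_le j s hs
    have heq : Ψ i j s = -Z j s - ∑ i' ∈ Finset.univ.erase i, Ψ i' j s := by linarith
    calc |Ψ i j s| = |-Z j s - ∑ i' ∈ Finset.univ.erase i, Ψ i' j s| := by rw [heq]
      _ ≤ |Z j s| + |∑ i' ∈ Finset.univ.erase i, Ψ i' j s| := by
        simpa only [abs_neg] using abs_sub (-Z j s) (∑ i' ∈ Finset.univ.erase i, Ψ i' j s)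
      _ ≤ _ := by linarith

lemma isDominated_of_forall_row {i : I} {j : J} (hμ : 0 < μ (i, j))
    (h : ∀ j', j' ≠ j → IsDominated E μ θ (i, j')) : IsDominated E μ θ (i, j) := by
  classical
  choose! C hC hbound using h
  set a := μ (i, j) with ha
  set R := Finset.univ.erase j with hR
  set K := 1 + |a - θ i| + ∑ j' ∈ R, |a - μ (i, j')| * C j' with hK
  have hCR : ∀ j' ∈ R, 0 ≤ C j' := fun j' hj' ↦ hC j' (Finset.ne_of_mem_erase hj')
  have hK0 : 0 ≤ K := by
    have : 0 ≤ ∑ j' ∈ R, |a - μ (i, j')| * C j' := Finset.sum_nonneg fun j' hj' ↦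
      mul_nonneg (abs_nonneg _) (hCR j' hj')
    positivity
  refine ⟨K / a + 1 + ∑ j' ∈ R, |1| * C j', ?_, fun T M X x Y W Z Ψ hflow s hs ↦ ?_⟩
  · have : 0 ≤ ∑ j' ∈ R, |1| * C j' := Finset.sum_nonneg fun j' hj' ↦
      mul_nonneg (abs_nonneg _) (hCR j' hj')
    positivity
  have hsum : ∀ c : J → ℝ, ∀ r ∈ Icc 0 T,
      |∑ j' ∈ R, c j' * Ψ i j' r| ≤ (∑ j' ∈ R, |c j'| * C j') * M := fun c r hr ↦
    abs_sum_mul_le R c (fun j' ↦ Ψ i j' r) C fun j' hj' ↦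
      hbound j' (Finset.ne_of_mem_erase hj') T M X x Y W Z Ψ hflow r hr
  have hrow : ∀ r ∈ Icc 0 T, Ψ i j r = X i r - Y i r - ∑ j' ∈ R, Ψ i j' r := fun r hr ↦ by
    rw [← hflow.row i r hr, hR, ← Finset.add_sum_erase _ _ (Finset.mem_univ j)]
    ring
  have hdrift : ∀ r ∈ Icc 0 T, |x i r + a * X i r| ≤ K * M := by
    intro r hr
    have hstate : x i r + a * X i r
        = W i r + (a - θ i) * Y i r + ∑ j' ∈ R, (a - μ (i, j')) * Ψ i j' r := by
      simp only [sub_mul, Finset.sum_sub_distrib, ← Finset.mul_sum]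
      rw [hflow.state i r hr, ← Finset.add_sum_erase _ _ (Finset.mem_univ j), ← ha, ← hR,
        hrow r hr]
      ring
    have hY : |(a - θ i) * Y i r| ≤ |a - θ i| * M := by
      rw [abs_mul]
      exact mul_le_mul_of_nonneg_left (hflow.abs_Y_le i r hr) (abs_nonneg _)
    have hW := hflow.abs_W_le i r hr
    have hΨ := hsum (fun j' ↦ a - μ (i, j')) r hr
    rw [hstate, hK]
    refine (abs_add_three _ _ _).trans ?_
    linarith
  have hX := abs_le_div_of_abs_hasDerivAt_add_mul_le hμ (mul_nonneg hK0 (hflow.nonneg i hs))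
    (hflow.hasDerivAt i) (hflow.X_zero i) hdrift s hs
  rw [mul_div_right_comm] at hX
  have hΨ := hsum (fun _ ↦ 1) s hs
  simp only [one_mul] at hΨ
  have hY := hflow.abs_Y_le i s hs
  calc |Ψ i j s| ≤ |X i s| + |Y i s| + |∑ j' ∈ R, Ψ i j' s| := by
        rw [hrow s hs]
        exact (abs_sub _ _).trans (add_le_add_left (abs_sub _ _) _)
    _ ≤ _ := by
      rw [add_mul, add_mul, one_mul]
      exact add_le_add_three hX hY hΨ

/-- If the activity graph is a forest, every activity is dominated: otherwise the graph of
activities that are not dominated would have a leaf. -/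
lemma isDominated_of_isAcyclic (hE : (actGraph E).IsAcyclic) (hμ : ∀ p ∈ E, 0 < μ p)
    (p : I × J) : IsDominated E μ θ p := by
  by_contra hp
  set U : Set (I × J) := {q | ¬ IsDominated E μ θ q} with hU
  have hUE : U ⊆ E := fun q hq ↦ by_contra fun hqE ↦ hq (isDominated_of_notMem hqE)
  obtain ⟨u, v, huv, huniq⟩ := (hE.anti (actGraph_mono hUE)).exists_adj_forall_adj_eq
    (actGraph_adj_inl_inr.mpr (show (p.1, p.2) ∈ U from hp))
  rcases u with i | j <;> rcases v with i' | j'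
  · exact actGraph_not_adj_inl_inl huv
  · have hij := actGraph_adj_inl_inr.mp huv
    refine hij (isDominated_of_forall_row (hμ _ (hUE hij)) fun k hk ↦ by_contra fun hnot ↦ hk ?_)
    exact Sum.inr_injective (huniq _ (actGraph_adj_inl_inr.mpr hnot))
  · have hij := actGraph_adj_inl_inr.mp huv.symm
    refine hij (isDominated_of_forall_column fun k hk ↦ by_contra fun hnot ↦ hk ?_)
    exact Sum.inl_injective (huniq _ (actGraph_adj_inl_inr.mpr hnot).symm)
  · exact actGraph_not_adj_inr_inr huv

end Flow

lemma 𝔍_zero_right (f : ℝ → ℝ) : 𝔍 f 0 = 0 := by simp [𝔍]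

lemma hasDerivAt_𝔍 {f : ℝ → ℝ} (hf : Continuous f) (s : ℝ) : HasDerivAt (𝔍 f) (f s) s :=
  hf.integral_hasStrictDerivAt 0 s |>.hasDerivAt

lemma continuous_𝔍 {f : ℝ → ℝ} (hf : Continuous f) : Continuous (𝔍 f) :=
  continuous_iff_continuousAt.mpr fun s ↦ (hasDerivAt_𝔍 hf s).continuousAt

lemma sum_𝔍 {ι : Type*} [Fintype ι] {f : ι → ℝ → ℝ} (hf : ∀ k, Continuous (f k)) (t : ℝ) :
    ∑ k, 𝔍 (f k) t = 𝔍 (fun s ↦ ∑ k, f k s) t :=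
  (intervalIntegral.integral_finsetSum fun k _ ↦ (hf k).intervalIntegrable _ _).symm

lemma 𝔍_congr {f g : ℝ → ℝ} {t : ℝ} (ht : 0 ≤ t) (h : ∀ s, 0 ≤ s → f s = g s) :
    𝔍 f t = 𝔍 g t := by
  refine intervalIntegral.integral_congr fun s hs ↦ h s ?_
  rw [uIcc_of_le ht] at hs
  exact hs.1

lemma abs_le_sSup_sum_abs {ι : Type*} [Fintype ι] {f : ι → ℝ → ℝ}
    (hf : ∀ k, Continuous (f k)) {t s : ℝ} (hs : s ∈ Icc 0 t) (k : ι) :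
    |f k s| ≤ sSup ((fun s ↦ ∑ k, |f k s|) '' Icc 0 t) := by
  have hcont : Continuous fun s ↦ ∑ k, |f k s| := by fun_prop
  exact (Finset.single_le_sum (f := fun k ↦ |f k s|) (fun _ _ ↦ abs_nonneg _)
    (Finset.mem_univ k)).trans
    (le_csSup (isCompact_Icc.image hcont).bddAbove (mem_image_of_mem _ hs))

lemma sSup_sum_abs_nonneg {ι : Type*} [Fintype ι] (f : ι → ℝ → ℝ) (S : Set ℝ) :
    0 ≤ sSup ((fun s ↦ ∑ k, |f k s|) '' S) := by
  refine Real.sSup_nonneg ?_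
  rintro _ ⟨s, _, rfl⟩
  exact Finset.sum_nonneg fun _ _ ↦ abs_nonneg _

/-- Proposition 1: if the buffer–station graph is a tree, then there is a
constant `m₁ > 0`, depending only on the structural data, such that any solution of
(33)–(35) satisfies
`∑_{i,j} |𝔍ψ_ij(t)| + ∑_i |x_i(t)| ≤ m₁ (‖w‖*_t + ‖𝔍y‖*_t + ‖𝔍z‖*_t)`. -/
theorem state_dominated_by_w_y_z
    {I J : Type*} [Fintype I] [Fintype J] [Nonempty I] [Nonempty J]
    (E : Set (I × J)) (μ : I × J → ℝ) (θ : I → ℝ)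
    (htree : (actGraph E).IsTree)
    (hμpos : ∀ p ∈ E, 0 < μ p) (hμzero : ∀ p : I × J, p ∉ E → μ p = 0)
    (hθ : ∀ i, 0 ≤ θ i) :
    ∃ m₁ : ℝ, 0 < m₁ ∧
      ∀ (x y w : I → ℝ → ℝ) (z : J → ℝ → ℝ) (ψ : I → J → ℝ → ℝ),
        (∀ i, Continuous (x i)) → (∀ i, Continuous (y i)) → (∀ i, Continuous (w i)) →
        (∀ j, Continuous (z j)) → (∀ i j, Continuous (ψ i j)) →
        (∀ i j, (i, j) ∉ E → ψ i j = 0) →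
        (∀ i, ∀ t : ℝ, 0 ≤ t →
          x i t = w i t - ∑ j, μ (i, j) * 𝔍 (ψ i j) t - θ i * 𝔍 (y i) t) →
        (∀ i, ∀ t : ℝ, 0 ≤ t → ∑ j, ψ i j t = x i t - y i t) →
        (∀ j, ∀ t : ℝ, 0 ≤ t → ∑ i, ψ i j t = - z j t) →
        ∀ t : ℝ, 0 ≤ t →
          (∑ i, ∑ j, |𝔍 (ψ i j) t|) + ∑ i, |x i t| ≤
            m₁ * (sSup ((fun s => ∑ i, |w i s|) '' Icc 0 t)
              + sSup ((fun s => ∑ i, |𝔍 (y i) s|) '' Icc 0 t)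
              + sSup ((fun s => ∑ j, |𝔍 (z j) s|) '' Icc 0 t)) := by
  choose C hC hbound using fun p ↦ isDominated_of_isAcyclic (θ := θ) htree.isAcyclic hμpos p
  have hD : ∀ i, 0 ≤ 1 + ∑ j, |μ (i, j)| * C (i, j) + θ i := fun i ↦ by
    have := hθ i
    have := Finset.sum_nonneg fun j (_ : j ∈ Finset.univ) ↦
      mul_nonneg (abs_nonneg (μ (i, j))) (hC (i, j))
    positivity
  have hCsum : 0 ≤ ∑ i, ∑ j, C (i, j) :=
    Finset.sum_nonneg fun i _ ↦ Finset.sum_nonneg fun j _ ↦ hC (i, j)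
  have hDsum := Finset.sum_nonneg fun i (_ : i ∈ Finset.univ) ↦ hD i
  refine ⟨∑ i, ∑ j, C (i, j) + ∑ i, (1 + ∑ j, |μ (i, j)| * C (i, j) + θ i) + 1,
    by positivity, ?_⟩
  intro x y w z ψ hx hy hw hz hψ hoff hstate hrow hcol t ht
  set M := sSup ((fun s => ∑ i, |w i s|) '' Icc 0 t)
    + sSup ((fun s => ∑ i, |𝔍 (y i) s|) '' Icc 0 t)
    + sSup ((fun s => ∑ j, |𝔍 (z j) s|) '' Icc 0 t) with hM
  have hw0 := sSup_sum_abs_nonneg w (Icc 0 t)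
  have hy0 := sSup_sum_abs_nonneg (fun i ↦ 𝔍 (y i)) (Icc 0 t)
  have hz0 := sSup_sum_abs_nonneg (fun j ↦ 𝔍 (z j)) (Icc 0 t)
  have hM0 : 0 ≤ M := by positivity
  have hflow : IsIntegratedFlow E μ θ t M (fun i ↦ 𝔍 (x i)) x (fun i ↦ 𝔍 (y i)) w
      (fun j ↦ 𝔍 (z j)) (fun i j ↦ 𝔍 (ψ i j)) :=
    { X_zero := fun i ↦ 𝔍_zero_right _
      hasDerivAt := fun i ↦ hasDerivAt_𝔍 (hx i)
      off := fun i j hij s ↦ by simp [hoff i j hij, 𝔍]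
      state := fun i s hs ↦ hstate i s hs.1
      row := fun i s hs ↦ by
        rw [sum_𝔍 (hψ i), 𝔍_congr hs.1 (hrow i)]
        exact intervalIntegral.integral_sub ((hx i).intervalIntegrable _ _)
          ((hy i).intervalIntegrable _ _)
      col := fun j s hs ↦ by
        rw [sum_𝔍 fun i ↦ hψ i j, 𝔍_congr hs.1 (hcol j)]
        exact intervalIntegral.integral_neg
      abs_W_le := fun i s hs ↦ by
        have := abs_le_sSup_sum_abs hw hs i
        linarith
      abs_Y_le := fun i s hs ↦ by
        have := abs_le_sSup_sum_abs (fun i ↦ continuous_𝔍 (hy i)) hs i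
        linarith
      abs_Z_le := fun j s hs ↦ by
        have := abs_le_sSup_sum_abs (fun j ↦ continuous_𝔍 (hz j)) hs j
        linarith }
  have htt : t ∈ Icc 0 t := ⟨ht, le_rfl⟩
  have hΨ : ∀ i j, |𝔍 (ψ i j) t| ≤ C (i, j) * M := fun i j ↦
    hbound (i, j) t M _ _ _ _ _ _ hflow t htt
  have hxle : ∀ i, |x i t| ≤ (1 + ∑ j, |μ (i, j)| * C (i, j) + θ i) * M := fun i ↦ by
    have h1 := hflow.abs_W_le i t htt
    have h2 := abs_sum_mul_le Finset.univ (fun j ↦ μ (i, j)) (fun j ↦ 𝔍 (ψ i j) t)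
      (fun j ↦ C (i, j)) fun j _ ↦ hΨ i j
    have h3 : |θ i * 𝔍 (y i) t| ≤ θ i * M := by
      rw [abs_mul, abs_of_nonneg (hθ i)]
      exact mul_le_mul_of_nonneg_left (hflow.abs_Y_le i t htt) (hθ i)
    rw [hstate i t ht]
    refine ((abs_sub _ _).trans (add_le_add_left (abs_sub _ _) _)).trans ?_
    linarith
  have hsumΨ : ∑ i, ∑ j, |𝔍 (ψ i j) t| ≤ (∑ i, ∑ j, C (i, j)) * M := by
    simp only [Finset.sum_mul]
    exact Finset.sum_le_sum fun i _ ↦ Finset.sum_le_sum fun j _ ↦ hΨ i j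
  have hsumx : ∑ i, |x i t| ≤ (∑ i, (1 + ∑ j, |μ (i, j)| * C (i, j) + θ i)) * M := by
    rw [Finset.sum_mul]
    exact Finset.sum_le_sum fun i _ ↦ hxle i
  linarith
end

section
/- Let I and J be nonempty finite sets and let μ_j > 0 for each j ∈ J. Suppose continuous functions y_i, w_i : [0,∞) → ℝ (i ∈ I), z_j : [0,∞) → ℝ (j ∈ J) and ψ_ij : [0,∞) → ℝ satisfy, for all t ≥ 0: ∑_{j∈J} (𝔗_{μ_j} ψ_ij)(t) = w_i(t) − y_i(t) for each i ∈ I; ∑_{i∈I} ψ_ij(t) = −z_j(t) for each j ∈ J; y_i(t) ≥ 0 and z_j(t) ≥ 0 for all i, j; and min(∑_{i∈I} y_i(t), ∑_{j∈J} z_j(t)) = 0. Then for all t ≥ 0: 0 ≤ ∑_{j∈J} z_j(t) ≤ max(0, −∑_{i∈I} w_i(t)). -/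
open MeasureTheory Set

/-- `(𝔗_α f)(t) = f(t) + α (𝔍 f)(t)`. -/
noncomputable def 𝔗 (α : ℝ) (f : ℝ → ℝ) : ℝ → ℝ := fun t => f t + α * 𝔍 f t

theorem 𝔍_nonneg {f : ℝ → ℝ} {t : ℝ} (ht : 0 ≤ t) (hf : ∀ s, 0 ≤ s → 0 ≤ f s) :
    0 ≤ 𝔍 f t :=
  intervalIntegral.integral_nonneg ht fun s hs => hf s hs.1

theorem sum_𝔍_eq_neg {I : Type*} [Fintype I] {f : I → ℝ → ℝ} {g : ℝ → ℝ} {t : ℝ}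
    (ht : 0 ≤ t) (hf : ∀ i, Continuous (f i)) (h : ∀ s, 0 ≤ s → ∑ i, f i s = -g s) :
    ∑ i, 𝔍 (f i) t = -𝔍 g t := by
  simp only [𝔍]
  rw [← intervalIntegral.integral_finsetSum fun i _ => (hf i).intervalIntegrable 0 t,
    ← intervalIntegral.integral_neg]
  refine intervalIntegral.integral_congr fun s hs => ?_
  rw [uIcc_of_le ht] at hs
  exact h s hs.1

theorem sum_𝔗_eq_neg {I : Type*} [Fintype I] (α : ℝ) {f : I → ℝ → ℝ} {g : ℝ → ℝ} {t : ℝ}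
    (ht : 0 ≤ t) (hf : ∀ i, Continuous (f i)) (h : ∀ s, 0 ≤ s → ∑ i, f i s = -g s) :
    ∑ i, 𝔗 α (f i) t = -𝔗 α g t := by
  simp only [𝔗]
  rw [Finset.sum_add_distrib, ← Finset.mul_sum, h t ht, sum_𝔍_eq_neg ht hf h]
  ring

/-- from the proof of Proposition 2, station-dependent case:
under (49)–(50), nonnegativity and the work-conservation condition,
`0 ≤ ∑_j z_j(t) ≤ (−∑_i w_i(t))⁺`. -/
theorem z_bounded_by_neg_part_of_w
    {I J : Type*} [Fintype I] [Fintype J] [Nonempty I] [Nonempty J]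
    (μ : J → ℝ) (hμ : ∀ j, 0 < μ j)
    (y w : I → ℝ → ℝ) (z : J → ℝ → ℝ) (ψ : I → J → ℝ → ℝ)
    (hy : ∀ i, Continuous (y i)) (hw : ∀ i, Continuous (w i))
    (hz : ∀ j, Continuous (z j)) (hψ : ∀ i j, Continuous (ψ i j))
    (heq1 : ∀ i, ∀ t : ℝ, 0 ≤ t → ∑ j, 𝔗 (μ j) (ψ i j) t = w i t - y i t)
    (heq2 : ∀ j, ∀ t : ℝ, 0 ≤ t → ∑ i, ψ i j t = - z j t)
    (hynn : ∀ i, ∀ t : ℝ, 0 ≤ t → 0 ≤ y i t)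
    (hznn : ∀ j, ∀ t : ℝ, 0 ≤ t → 0 ≤ z j t)
    (hmin : ∀ t : ℝ, 0 ≤ t → min (∑ i, y i t) (∑ j, z j t) = 0) :
    ∀ t : ℝ, 0 ≤ t →
      0 ≤ ∑ j, z j t ∧ ∑ j, z j t ≤ max 0 (-∑ i, w i t) := by
  intro t ht
  have hZ : 0 ≤ ∑ j, z j t := Finset.sum_nonneg fun j _ => hznn j t ht
  refine ⟨hZ, ?_⟩
  have hsum : -∑ j, 𝔗 (μ j) (z j) t = ∑ i, w i t - ∑ i, y i t := by
    rw [← Finset.sum_sub_distrib, ← Finset.sum_congr rfl fun i _ => heq1 i t ht,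
      Finset.sum_comm, ← Finset.sum_neg_distrib]
    exact Finset.sum_congr rfl fun j _ =>
      (sum_𝔗_eq_neg (μ j) ht (fun i => hψ i j) (heq2 j)).symm
  have hle : ∑ j, z j t ≤ ∑ j, 𝔗 (μ j) (z j) t := Finset.sum_le_sum fun j _ =>
    le_add_of_nonneg_right (mul_nonneg (hμ j).le (𝔍_nonneg ht (hznn j)))
  rcases min_choice (∑ i, y i t) (∑ j, z j t) with h | h <;> rw [hmin t ht] at h
  · exact le_max_of_le_right (by linarith)
  · exact le_max_of_le_left h.ge
end

section
/- Let I and J be nonempty finite sets and let μ_i > 0 for each i ∈ I. There exists a constant m₂ > 0, depending only on I, J and (μ_i), such that whenever continuous functions y_i, w_i : [0,∞) → ℝ (i ∈ I), z_j : [0,∞) → ℝ (j ∈ J) and ψ_ij : [0,∞) → ℝ satisfy, for all t ≥ 0: (𝔗_{μ_i}(∑_{j∈J} ψ_ij))(t) = w_i(t) − y_i(t) for each i ∈ I; ∑_{i∈I} ψ_ij(t) = −z_j(t) for each j ∈ J; y_i(t) ≥ 0 and z_j(t) ≥ 0 for all i, j; and min(∑_{i∈I} y_i(t), ∑_{j∈J}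 z_j(t)) = 0; then for all t ≥ 0: ∑_{i∈I} |y_i(t)| + ∑_{j∈J} |z_j(t)| ≤ m₂ (1+t)^{m₂} · sup_{0≤s≤t} ∑_{i∈I} |w_i(s)|. -/
open MeasureTheory Set

/-- If `φ + α 𝔍 φ ≤ C` on `[0, T]` with `0 < α` and `0 ≤ C`, then `𝔍 φ ≤ C / α` on `[0, T]`. -/
theorem 𝔍_le_div_of_𝔗_le {φ : ℝ → ℝ} (hφ : Continuous φ) {α C T : ℝ} (hα : 0 < α) (hC : 0 ≤ C)
    (h : ∀ s ∈ Icc 0 T, 𝔗 α φ s ≤ C) {t : ℝ} (ht : t ∈ Icc 0 T) : 𝔍 φ t ≤ C / α := by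
  have hd (s : ℝ) : HasDerivAt (fun r => Real.exp (α * r) * (𝔍 φ r - C / α))
      (Real.exp (α * s) * (𝔗 α φ s - C)) s := by
    have h1 : HasDerivAt (𝔍 φ) (φ s) s :=
      intervalIntegral.integral_hasDerivAt_right (hφ.intervalIntegrable _ _)
        (hφ.stronglyMeasurableAtFilter _ _) hφ.continuousAt
    have h2 : HasDerivAt (fun r => Real.exp (α * r)) (Real.exp (α * s) * (α * 1)) s :=
      ((hasDerivAt_id s).const_mul α).exp
    refine (h2.mul (h1.sub_const (C / α))).congr_deriv ?_
    simp only [𝔗]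
    field_simp
    ring
  have hanti : AntitoneOn (fun r => Real.exp (α * r) * (𝔍 φ r - C / α)) (Icc 0 T) := by
    apply antitoneOn_of_deriv_nonpos (convex_Icc 0 T)
    · exact fun s _ => (hd s).continuousAt.continuousWithinAt
    · exact fun s _ => (hd s).differentiableAt.differentiableWithinAt
    · intro s hs
      rw [(hd s).deriv]
      exact mul_nonpos_of_nonneg_of_nonpos (Real.exp_pos _).le
        (sub_nonpos.2 (h s (interior_subset hs)))
  have h0 := hanti (left_mem_Icc.2 (ht.1.trans ht.2)) ht ht.1
  have hz : 𝔍 φ 0 = 0 := intervalIntegral.integral_same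
  simp only [hz, mul_zero, Real.exp_zero, one_mul, zero_sub] at h0
  have h3 : 0 ≤ C / α := by positivity
  by_contra! hlt
  have := mul_pos (Real.exp_pos (α * t)) (sub_pos.2 hlt)
  linarith

/-- Proposition 2, class-dependent case `μ_ij = μ_i`:
there is `m₂ > 0`, depending only on the structural data, such that
`∑_i |y_i(t)| + ∑_j |z_j(t)| ≤ m₂ (1+t)^{m₂} sup_{0≤s≤t} ∑_i |w_i(s)|`. -/
theorem y_z_polynomial_bound_class_dependent
    {I J : Type*} [Fintype I] [Fintype J] [Nonempty I] [Nonempty J]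
    (μ : I → ℝ) (hμ : ∀ i, 0 < μ i) :
    ∃ m₂ : ℝ, 0 < m₂ ∧
      ∀ (y w : I → ℝ → ℝ) (z : J → ℝ → ℝ) (ψ : I → J → ℝ → ℝ),
        (∀ i, Continuous (y i)) → (∀ i, Continuous (w i)) →
        (∀ j, Continuous (z j)) → (∀ i j, Continuous (ψ i j)) →
        (∀ i, ∀ t : ℝ, 0 ≤ t →
          𝔗 (μ i) (fun s => ∑ j, ψ i j s) t = w i t - y i t) →
        (∀ j, ∀ t : ℝ, 0 ≤ t → ∑ i, ψ i j t = - z j t) →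
        (∀ i, ∀ t : ℝ, 0 ≤ t → 0 ≤ y i t) →
        (∀ j, ∀ t : ℝ, 0 ≤ t → 0 ≤ z j t) →
        (∀ t : ℝ, 0 ≤ t → min (∑ i, y i t) (∑ j, z j t) = 0) →
        ∀ t : ℝ, 0 ≤ t →
          (∑ i, |y i t|) + ∑ j, |z j t| ≤
            m₂ * (1 + t) ^ m₂ * sSup ((fun s => ∑ i, |w i s|) '' Icc 0 t) := by
  have hM (i) : μ i ≤ ∑ k, μ k :=
    Finset.single_le_sum (fun k _ => (hμ k).le) (Finset.mem_univ i)
  set M := ∑ i, μ i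
  have hM0 : 0 ≤ M := Finset.sum_nonneg fun i _ => (hμ i).le
  set R := ∑ i, 1 / μ i with hR
  have hR0 : 0 ≤ R := Finset.sum_nonneg fun i _ => (one_div_pos.2 (hμ i)).le
  set n : ℝ := (Fintype.card I : ℝ)
  have hn0 : 0 ≤ n := Nat.cast_nonneg _
  refine ⟨3 + 2 * n + M * R + M * (n + 1), by positivity, ?_⟩
  intro y w z ψ _ hw _ hψ hT hsum hy hz hmin T hT0
  set W := sSup ((fun s => ∑ i, |w i s|) '' Icc 0 T)
  have hbdd : BddAbove ((fun s => ∑ i, |w i s|) '' Icc 0 T) :=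
    isCompact_Icc.bddAbove_image (by fun_prop)
  have hwW {s : ℝ} (hs : s ∈ Icc 0 T) : ∑ i, |w i s| ≤ W := le_csSup hbdd ⟨s, hs, rfl⟩
  have hwi {s : ℝ} (hs : s ∈ Icc 0 T) (i) : w i s ≤ W :=
    (le_abs_self _).trans ((Finset.single_le_sum (f := fun k => |w k s|)
      (fun k _ => abs_nonneg _) (Finset.mem_univ i)).trans (hwW hs))
  have hW0 : 0 ≤ W :=
    (Finset.sum_nonneg fun i _ => abs_nonneg (w i T)).trans (hwW (right_mem_Icc.2 hT0))
  set φ : I → ℝ → ℝ := fun i s => ∑ j, ψ i j s with hφ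
  have hφc (i) : Continuous (φ i) := by fun_prop
  have hx {s : ℝ} (hs : s ∈ Icc 0 T) (i) : 𝔍 (φ i) s ≤ W / μ i :=
    𝔍_le_div_of_𝔗_le (hφc i) (hμ i) hW0
      (fun r hr => by linarith [hT i r hr.1, hy i r hr.1, hwi hr i]) hs
  have hφz {s : ℝ} (hs : 0 ≤ s) : ∑ i, φ i s = -∑ j, z j s := by
    rw [hφ, Finset.sum_comm, ← Finset.sum_neg_distrib]
    exact Finset.sum_congr rfl fun j _ => hsum j s hs
  have hbal {s : ℝ} (hs : 0 ≤ s) :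
      -∑ j, z j s + ∑ i, μ i * 𝔍 (φ i) s = ∑ i, w i s - ∑ i, y i s := by
    rw [← hφz hs, ← Finset.sum_add_distrib, ← Finset.sum_sub_distrib]
    exact Finset.sum_congr rfl fun i _ => hT i s hs
  have hwabs {s : ℝ} (hs : s ∈ Icc 0 T) : |∑ i, w i s| ≤ W :=
    (Finset.abs_sum_le_sum_abs _ _).trans (hwW hs)
  have hZ {s : ℝ} (hs : s ∈ Icc 0 T) : ∑ j, z j s ≤ (n + 1) * W := by
    rcases min_choice (∑ i, y i s) (∑ j, z j s) with h | h <;> rw [hmin s hs.1] at h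
    · have h1 : ∑ i, μ i * 𝔍 (φ i) s ≤ ∑ _i : I, W := by
        refine Finset.sum_le_sum fun i _ => ?_
        have := (le_div_iff₀ (hμ i)).1 (hx hs i)
        linarith
      rw [Finset.sum_const, Finset.card_univ, nsmul_eq_mul] at h1
      linarith [hbal hs.1, neg_abs_le (∑ i, w i s), hwabs hs]
    · rw [← h]
      positivity
  have hTm : T ∈ Icc 0 T := right_mem_Icc.2 hT0
  have hS : -((n + 1) * W * T) ≤ ∑ i, 𝔍 (φ i) T := by
    have h1 : ∑ i, 𝔍 (φ i) T = ∫ s in (0 : ℝ)..T, ∑ i, φ i s :=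
      (intervalIntegral.integral_finsetSum fun i _ => (hφc i).intervalIntegrable _ _).symm
    have h2 := intervalIntegral.integral_mono_on (μ := volume) hT0
      (intervalIntegrable_const (c := -((n + 1) * W)))
      ((continuous_finsetSum Finset.univ fun i _ => hφc i).intervalIntegrable 0 T)
      (fun s hs => by rw [hφz hs.1]; linarith [hZ hs])
    rw [intervalIntegral.integral_const, smul_eq_mul] at h2
    rw [h1]
    linarith
  have hY : n * W - ∑ i, μ i * 𝔍 (φ i) T ≤ M * (W * R - ∑ i, 𝔍 (φ i) T) := by
    have h1 : ∑ i, μ i * (W / μ i - 𝔍 (φ i) T) ≤ ∑ i, M * (W / μ i - 𝔍 (φ i) T) :=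
      Finset.sum_le_sum fun i _ => mul_le_mul_of_nonneg_right (hM i) (sub_nonneg.2 (hx hTm i))
    have h2 : ∑ i, μ i * (W / μ i - 𝔍 (φ i) T) = n * W - ∑ i, μ i * 𝔍 (φ i) T := by
      simp_rw [mul_sub, mul_div_cancel₀ W (hμ _).ne']
      rw [Finset.sum_sub_distrib, Finset.sum_const, Finset.card_univ, nsmul_eq_mul]
    have h3 : ∑ i, M * (W / μ i - 𝔍 (φ i) T) = M * (W * R - ∑ i, 𝔍 (φ i) T) := by
      rw [← Finset.mul_sum, Finset.sum_sub_distrib, hR, Finset.mul_sum]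
      simp_rw [mul_one_div]
    rwa [h2, h3] at h1
  have hyabs : ∑ i, |y i T| = ∑ i, y i T :=
    Finset.sum_congr rfl fun i _ => abs_of_nonneg (hy i T hT0)
  have hzabs : ∑ j, |z j T| = ∑ j, z j T :=
    Finset.sum_congr rfl fun j _ => abs_of_nonneg (hz j T hT0)
  rw [hyabs, hzabs]
  set m := 3 + 2 * n + M * R + M * (n + 1)
  have hm1 : 1 ≤ m := by
    have : 0 ≤ M * R + M * (n + 1) := by positivity
    simp only [m]
    linarith
  have hpow : 1 + T ≤ (1 + T) ^ m := Real.self_le_rpow_of_one_le (by linarith) hm1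
  calc (∑ i, y i T) + ∑ j, z j T
      ≤ m * (1 + T) * W := by
        have h1 : M * (W * R - ∑ i, 𝔍 (φ i) T) ≤ M * (W * R + (n + 1) * W * T) :=
          mul_le_mul_of_nonneg_left (by linarith) hM0
        have h2 : (∑ i, y i T) + ∑ j, z j T ≤
            W + 2 * ((n + 1) * W) + M * (W * R + (n + 1) * W * T) := by
          have : 0 ≤ n * W := by positivity
          linarith [hbal hT0, hZ hTm, le_abs_self (∑ i, w i T), hwabs hTm]
        have h3 : 0 ≤ (3 + 2 * n + M * R) * T * W + M * (n + 1) * W := by positivity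
        simp only [m]
        linarith
    _ ≤ m * (1 + T) ^ m * W := by gcongr
end

section
/- Assume in addition that θ_i ≤ μ_{i j₀} for every i ∈ I. Then the system (66)–(69) has the nonidling property: for every T > 0 and every family of measurable, locally bounded functions (ψ_ij, y_i, z_j, w_i) satisfying (66)–(69) on [0,T) in which each w_i is right-continuous, strictly increasing and satisfies w_i(0) > 0, one has z_j(t) = 0 for all j ∈ J and all t ∈ [0,T). -/
open MeasureTheory Set

/-- The system (66)–(69) on the time set `S`, for the diameter-≤3 tree whose activity set
is `E = {(i,j₀) : i ∈ I} ∪ {(i₀,j) : j ∈ J}`. -/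
def Sys {I J : Type*} [Fintype I] [Fintype J] (i₀ : I) (j₀ : J)
    (μ : I × J → ℝ) (θ : I → ℝ)
    (ψ : I → J → ℝ → ℝ) (y w : I → ℝ → ℝ) (z : J → ℝ → ℝ) (S : Set ℝ) : Prop :=
  (∀ i j, ¬(j = j₀ ∨ i = i₀) → ∀ t ∈ S, ψ i j t = 0) ∧
  (∀ i, ∀ t ∈ S, ∑ j, (ψ i j t + μ (i, j) * 𝔍 (ψ i j) t)
      = w i t - y i t - θ i * 𝔍 (y i) t) ∧
  (∀ j, ∀ t ∈ S, ∑ i, ψ i j t = - z j t) ∧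
  (∀ i, ∀ t ∈ S, 0 ≤ y i t) ∧
  (∀ j, ∀ t ∈ S, 0 ≤ z j t) ∧
  (∀ t ∈ S, min (∑ i, y i t) (∑ j, z j t) = 0)

/-- `f` is measurable and locally bounded on `[0, T)`. -/
def MeasLB (f : ℝ → ℝ) (T : ℝ) : Prop :=
  Measurable f ∧ ∀ b : ℝ, 0 ≤ b → b < T → ∃ C : ℝ, ∀ t ∈ Icc (0:ℝ) b, |f t| ≤ C

/-- `f` is measurable and locally bounded on `[0, ∞)`. -/
def MeasLBInf (f : ℝ → ℝ) : Prop :=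
  Measurable f ∧ ∀ b : ℝ, 0 ≤ b → ∃ C : ℝ, ∀ t ∈ Icc (0:ℝ) b, |f t| ≤ C

/-- The nonidling property of the system (66)–(69): whenever each `w_i` is right-continuous,
strictly increasing on `[0,T)` and `w_i(0) > 0`, the system incurs no idleness on `[0,T)`. -/
def Nonidling {I J : Type*} [Fintype I] [Fintype J] (i₀ : I) (j₀ : J)
    (μ : I × J → ℝ) (θ : I → ℝ) : Prop :=
  ∀ T : ℝ, 0 < T →
    ∀ (ψ : I → J → ℝ → ℝ) (y w : I → ℝ → ℝ) (z : J → ℝ → ℝ),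
      (∀ i j, MeasLB (ψ i j) T) → (∀ i, MeasLB (y i) T) → (∀ i, MeasLB (w i) T) →
      (∀ j, MeasLB (z j) T) →
      (∀ i, ∀ t ∈ Ico (0:ℝ) T, ContinuousWithinAt (w i) (Ici t) t) →
      (∀ i, StrictMonoOn (w i) (Ico (0:ℝ) T)) →
      (∀ i, 0 < w i 0) →
      Sys i₀ j₀ μ θ ψ y w z (Ico (0:ℝ) T) →
      ∀ j, ∀ t ∈ Ico (0:ℝ) T, z j t = 0

theorem MeasLB.intervalIntegrable {f : ℝ → ℝ} {T t : ℝ} (hf : MeasLB f T) (ht : t ∈ Ico (0:ℝ) T) :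
    IntervalIntegrable f volume 0 t := by
  obtain ⟨C, hC⟩ := hf.2 t ht.1 ht.2
  rw [intervalIntegrable_iff_integrableOn_Icc_of_le ht.1]
  exact Measure.integrableOn_of_bounded (M := C) (by simp) hf.1.aestronglyMeasurable
    ((ae_restrict_iff' measurableSet_Icc).2 (Filter.Eventually.of_forall fun s hs => hC s hs))

theorem continuousOn_𝔍 {f : ℝ → ℝ} {t : ℝ} (ht : 0 ≤ t) (hf : IntervalIntegrable f volume 0 t) :
    ContinuousOn (𝔍 f) (Icc 0 t) := by
  have h := intervalIntegral.continuousOn_primitive_interval' hf (left_mem_uIcc)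
  rwa [uIcc_of_le ht] at h

theorem IntervalIntegrable.of_mem_Icc {f : ℝ → ℝ} {t s : ℝ}
    (hf : IntervalIntegrable f volume 0 t) (hs : s ∈ Icc (0:ℝ) t) :
    IntervalIntegrable f volume 0 s :=
  hf.mono_set (by
    rw [uIcc_of_le hs.1, uIcc_of_le (hs.1.trans hs.2)]
    exact Icc_subset_Icc_right hs.2)

theorem ContinuousOn.continuousWithinAt_Ici {f : ℝ → ℝ} {a t s : ℝ}
    (hf : ContinuousOn f (Icc a t)) (hs : s ∈ Ico a t) : ContinuousWithinAt f (Ici s) s :=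
  (hf s ⟨hs.1, hs.2.le⟩).mono_of_mem_nhdsWithin
    (Filter.mem_of_superset (Icc_mem_nhdsGE hs.2) (Icc_subset_Icc_left hs.1))

theorem monotoneOn_𝔍 {f : ℝ → ℝ} {t : ℝ} (hf : IntervalIntegrable f volume 0 t)
    (hnonneg : ∀ s ∈ Icc (0:ℝ) t, 0 ≤ f s) : MonotoneOn (𝔍 f) (Icc 0 t) := by
  intro a ha b hb hab
  exact intervalIntegral.integral_mono_interval le_rfl ha.1 hab
    ((ae_restrict_iff' measurableSet_Ioc).2 (Filter.Eventually.of_forall fun s hs =>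
      hnonneg s ⟨hs.1.le, hs.2.trans hb.2⟩)) (hf.of_mem_Icc hb)

/-- A solution of the linear Volterra equation `f + c 𝔍 f = g` driven by a monotone
right-continuous `g` with `g 0 > 0` stays positive up to the terminal time. -/
theorem sub_mul_𝔍_pos {f g : ℝ → ℝ} {c t : ℝ} (hc : 0 < c) (ht : 0 ≤ t) (hfm : Measurable f)
    (hfi : IntervalIntegrable f volume 0 t) (hg : MonotoneOn g (Icc 0 t))
    (hgc : ∀ s ∈ Ico (0:ℝ) t, ContinuousWithinAt g (Ici s) s) (hg0 : 0 < g 0)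
    (hfg : ∀ s ∈ Ico (0:ℝ) t, f s = g s - c * 𝔍 f s) :
    0 < g t - c * 𝔍 f t := by
  have hFc := continuousOn_𝔍 ht hfi
  have hfc : ∀ s ∈ Ico (0:ℝ) t, ContinuousWithinAt f (Ici s) s := by
    intro s hs
    refine ContinuousWithinAt.congr_of_eventuallyEq
      ((hgc s hs).sub ((hFc.continuousWithinAt_Ici hs).const_mul c)) ?_ (hfg s hs)
    filter_upwards [Ico_mem_nhdsGE hs.2] with r hr
    exact hfg r ⟨hs.1.trans hr.1, hr.2⟩
  have hFd : ∀ s ∈ Ico (0:ℝ) t, HasDerivWithinAt (𝔍 f) (f s) (Ici s) s := fun s hs =>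
    intervalIntegral.integral_hasDerivWithinAt_right (hfi.of_mem_Icc ⟨hs.1, hs.2.le⟩)
      hfm.stronglyMeasurable.stronglyMeasurableAtFilter ((hfc s hs).mono Ioi_subset_Ici_self)
  have hexp : ∀ s : ℝ, HasDerivAt (fun r => Real.exp (c * r)) (Real.exp (c * s) * c) s := by
    intro s
    simpa using ((hasDerivAt_id s).const_mul c).exp
  have key := image_le_of_deriv_right_le_deriv_boundary
    (f := fun s => Real.exp (c * s) * 𝔍 f s)
    (f' := fun s => Real.exp (c * s) * c * 𝔍 f s + Real.exp (c * s) * f s)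
    (B := fun s => g t / c * (Real.exp (c * s) - 1))
    (B' := fun s => g t / c * (Real.exp (c * s) * c)) (a := 0) (b := t)
    ((by fun_prop : Continuous fun s : ℝ => Real.exp (c * s)).continuousOn.mul hFc)
    (fun s hs => (hexp s).hasDerivWithinAt.mul (hFd s hs))
    (by simp [𝔍])
    (by fun_prop)
    (fun s _ => (((hexp s).sub_const 1).const_mul _).hasDerivWithinAt)
    (by
      intro s hs
      have h1 : g s ≤ g t := hg ⟨hs.1, hs.2.le⟩ ⟨ht, le_rfl⟩ hs.2.le
      have h2 : g t / c * (Real.exp (c * s) * c) = Real.exp (c * s) * g t := by field_simp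
      rw [h2, hfg s hs]
      have := mul_le_mul_of_nonneg_left h1 (Real.exp_pos (c * s)).le
      linarith)
    ⟨ht, le_rfl⟩
  have hgt : 0 < g t := hg0.trans_le (hg ⟨le_rfl, ht⟩ ⟨ht, le_rfl⟩ ht)
  have hE := Real.exp_pos (c * t)
  have h3 : c * (g t / c * (Real.exp (c * t) - 1)) = g t * (Real.exp (c * t) - 1) := by field_simp
  have h4 := mul_le_mul_of_nonneg_left key hc.le
  simp only [h3] at h4
  have h5 : 0 < Real.exp (c * t) * (g t - c * 𝔍 f t) := by nlinarith
  exact pos_of_mul_pos_right h5 hE.le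

theorem 𝔍_eq_zero {f : ℝ → ℝ} {s : ℝ} (hs : 0 ≤ s) (hf : ∀ r ∈ Ico (0:ℝ) s, f r = 0) :
    𝔍 f s = 0 := by
  unfold 𝔍
  rw [intervalIntegral.integral_of_le hs, integral_Ioc_eq_integral_Ioo]
  exact setIntegral_eq_zero_of_forall_eq_zero fun r hr => hf r ⟨hr.1.le, hr.2⟩

/-- If a property holds at `t ∈ [0, T)` as soon as it holds on `[0, t)`, and propagates to the
right, then it holds on `[0, T)`. -/
theorem forall_mem_Ico_of_right_propagation {P : ℝ → Prop} {T : ℝ}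
    (hstep : ∀ t ∈ Ico (0:ℝ) T, (∀ s ∈ Ico (0:ℝ) t, P s) → P t)
    (hright : ∀ t ∈ Ico (0:ℝ) T, P t → ∀ᶠ s in nhdsWithin t (Ici t), P s) :
    ∀ t ∈ Ico (0:ℝ) T, P t := by
  intro t ht
  by_contra hn
  set S : Set ℝ := {s | s ∈ Icc 0 t ∧ ¬ P s}
  have hne : S.Nonempty := ⟨t, ⟨ht.1, le_rfl⟩, hn⟩
  have hbdd : BddBelow S := ⟨0, fun s hs => hs.1.1⟩
  have hτ0 : 0 ≤ sInf S := le_csInf hne fun s hs => hs.1.1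
  have hτt : sInf S ≤ t := csInf_le hbdd ⟨⟨ht.1, le_rfl⟩, hn⟩
  have hτ : sInf S ∈ Ico (0:ℝ) T := ⟨hτ0, hτt.trans_lt ht.2⟩
  have hP := hright _ hτ (hstep _ hτ fun s hs => by
    by_contra h
    exact absurd (csInf_le hbdd (show s ∈ S from ⟨⟨hs.1, hs.2.le.trans hτt⟩, h⟩)) hs.2.not_ge)
  obtain ⟨u, hu, hPu⟩ := mem_nhdsGE_iff_exists_Ico_subset.1 hP
  obtain ⟨s, hs, hsu⟩ := exists_lt_of_csInf_lt hne hu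
  exact hs.2 (hPu ⟨csInf_le hbdd hs, hsu⟩)

/-- Lemma 3: for a tree of diameter at most 3, if `θ_i ≤ μ_{i j₀}` for
every `i`, then the system (66)–(69) has the nonidling property. -/
theorem nonidling_holds_of_theta_le_mu
    {I J : Type*} [Fintype I] [Fintype J] [Nonempty I] [Nonempty J]
    (i₀ : I) (j₀ : J) (μ : I × J → ℝ) (θ : I → ℝ)
    (hμpos : ∀ i j, (j = j₀ ∨ i = i₀) → 0 < μ (i, j))
    (hμzero : ∀ i j, ¬(j = j₀ ∨ i = i₀) → μ (i, j) = 0)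
    (hθ : ∀ i, 0 ≤ θ i)
    (hθμ : ∀ i, θ i ≤ μ (i, j₀)) :
    Nonidling i₀ j₀ μ θ := by
  intro T hT ψ y w z hψ hy hw hz hwc hwm hw0 ⟨hoff, hbal, hpool, hy0, hz0, hmin⟩
  set x : I → ℝ → ℝ := fun i t => w i t - ∑ j, μ (i, j) * 𝔍 (ψ i j) t - θ i * 𝔍 (y i) t with hx
  have hxeq : ∀ i, ∀ t ∈ Ico (0:ℝ) T, x i t = ∑ j, ψ i j t + y i t := by
    intro i t ht
    have := hbal i t ht
    rw [Finset.sum_add_distrib] at this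
    simp only [hx]
    linarith
  have hX : ∀ t ∈ Ico (0:ℝ) T, ∑ i, x i t = ∑ i, y i t - ∑ j, z j t := by
    intro t ht
    rw [Finset.sum_congr rfl fun i _ => hxeq i t ht, Finset.sum_add_distrib, Finset.sum_comm,
      Finset.sum_congr rfl fun j _ => hpool j t ht, Finset.sum_neg_distrib]
    ring
  have hzero : ∀ t ∈ Ico (0:ℝ) T, 0 < ∑ i, x i t → ∀ j, z j t = 0 := by
    intro t ht hpos j
    have hZ0 : 0 ≤ ∑ j, z j t := Finset.sum_nonneg fun j _ => hz0 j t ht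
    have hZ : ∑ j, z j t = 0 := by
      have h := hX t ht
      rcases min_choice (∑ i, y i t) (∑ j, z j t) with h' | h' <;> have := hmin t ht <;> linarith
    exact (Finset.sum_eq_zero_iff_of_nonneg fun j _ => hz0 j t ht).1 hZ j (Finset.mem_univ j)
  have hcont𝔍 : ∀ f, MeasLB f T → ∀ t ∈ Ico (0:ℝ) T, ContinuousWithinAt (𝔍 f) (Ici t) t := by
    intro f hf t ht
    obtain ⟨b, htb, hbT⟩ := exists_between ht.2
    have hb : b ∈ Ico (0:ℝ) T := ⟨ht.1.trans htb.le, hbT⟩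
    exact (continuousOn_𝔍 hb.1 (hf.intervalIntegrable hb)).continuousWithinAt_Ici ⟨ht.1, htb⟩
  suffices hpos : ∀ t ∈ Ico (0:ℝ) T, 0 < ∑ i, x i t from
    fun j t ht => hzero t ht (hpos t ht) j
  refine forall_mem_Ico_of_right_propagation ?_ ?_
  · intro t ht hlt
    refine Finset.sum_pos (fun i _ => ?_) Finset.univ_nonempty
    have hψ0 : ∀ j, j ≠ j₀ → ∀ s ∈ Ico (0:ℝ) t, ψ i j s = 0 := by
      intro j hj s hs
      have hsT : s ∈ Ico (0:ℝ) T := ⟨hs.1, hs.2.trans ht.2⟩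
      by_cases hi : i = i₀
      · subst hi
        have h := hpool j s hsT
        rwa [hzero s hsT (hlt s hs) j, neg_zero, Fintype.sum_eq_single i fun k hk =>
          hoff k j (by tauto) s hsT] at h
      · exact hoff i j (by tauto) s hsT
    have hxs : ∀ s ∈ Icc (0:ℝ) t,
        x i s = w i s - μ (i, j₀) * 𝔍 (ψ i j₀) s - θ i * 𝔍 (y i) s := by
      intro s hs
      simp only [hx]
      rw [Fintype.sum_eq_single j₀ fun j hj => by
        rw [𝔍_eq_zero hs.1 fun r hr => hψ0 j hj r ⟨hr.1, hr.2.trans_le hs.2⟩, mul_zero]]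
    have hψi := (hψ i j₀).intervalIntegrable ht
    have hyi := (hy i).intervalIntegrable ht
    have hadd : ∀ s ∈ Icc (0:ℝ) t,
        𝔍 (fun r => ψ i j₀ r + y i r) s = 𝔍 (ψ i j₀) s + 𝔍 (y i) s := fun s hs =>
      intervalIntegral.integral_add (hψi.of_mem_Icc hs) (hyi.of_mem_Icc hs)
    have hd : 0 ≤ μ (i, j₀) - θ i := sub_nonneg.2 (hθμ i)
    have hmain := sub_mul_𝔍_pos (f := fun r => ψ i j₀ r + y i r)
      (g := fun s => w i s + (μ (i, j₀) - θ i) * 𝔍 (y i) s)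
      (hμpos i j₀ (Or.inl rfl)) ht.1 ((hψ i j₀).1.add (hy i).1) (hψi.add hyi)
      (by
        intro a ha b hb hab
        have h1 := (hwm i).monotoneOn ⟨ha.1, ha.2.trans_lt ht.2⟩ ⟨hb.1, hb.2.trans_lt ht.2⟩ hab
        have h2 := monotoneOn_𝔍 hyi (fun s hs => hy0 i s ⟨hs.1, hs.2.trans_lt ht.2⟩) ha hb hab
        exact add_le_add h1 (mul_le_mul_of_nonneg_left h2 hd))
      (fun s hs => (hwc i s ⟨hs.1, hs.2.trans ht.2⟩).add
        ((hcont𝔍 _ (hy i) s ⟨hs.1, hs.2.trans ht.2⟩).const_mul _))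
      (by simpa [𝔍] using hw0 i)
      (by
        intro s hs
        have hsI : s ∈ Icc (0:ℝ) t := ⟨hs.1, hs.2.le⟩
        have h := hxeq i s ⟨hs.1, hs.2.trans ht.2⟩
        rw [hxs s hsI, Fintype.sum_eq_single j₀ fun j hj => hψ0 j hj s hs] at h
        rw [hadd s hsI]
        linarith)
    rw [hadd t ⟨ht.1, le_rfl⟩] at hmain
    rw [hxs t ⟨ht.1, le_rfl⟩]
    linarith
  · intro t ht hpos
    have hc : ContinuousWithinAt (fun s => ∑ i, x i s) (Ici t) t :=
      tendsto_finsetSum _ fun i _ => ((hwc i t ht).sub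
        (tendsto_finsetSum _ fun j _ => (hcont𝔍 _ (hψ i j) t ht).const_mul _)).sub
        ((hcont𝔍 _ (hy i) t ht).const_mul _)
    exact hc.eventually (lt_mem_nhds hpos)
end
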